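/- Let L > 0 and λ' > λ > 0 be real numbers, and let h : [0,L] → ℝ be smooth with h(t) > 0 for all t ∈ [0,L), h(L) = 0, and h'(L) = −1. Then σ_rev(λ',h,L) − σ_rev(λ,h,L) < L(λ'−λ)/h(0)². In particular, taking λ = j(j+1) and λ' = (j+1)(j+2), the gap between the (j+1)-st and j-th distinct Steklov eigenvalues satisfies σ_{(j+1)}(h) − σ_{(j)}(h) < L(λ_{(j+1)}−λ_{(j)})/h(0)². (This is the paper's spectral gap Theorem for metrics of revolution.) -/

import Mathlib

open Set intervalIntegral

/-- The revolution Steklov–Rayleigh infimum `σ_rev(λ, h, L)`: the infimum, over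
continuously differentiable `a : ℝ → ℝ` with `a 0 = 1` and `a L = 0`, of
`(1 / h(0)²) ∫₀ᴸ (a'(t)² h(t)² + λ a(t)²) dt`. -/
noncomputable def steklovRayleighRev (lam L : ℝ) (h : ℝ → ℝ) : ℝ :=
  sInf { x : ℝ | ∃ a : ℝ → ℝ, ContDiff ℝ 1 a ∧ a 0 = 1 ∧ a L = 0 ∧
    x = (1 / (h 0) ^ 2) *
      ∫ t in (0:ℝ)..L, ((deriv a t) ^ 2 * (h t) ^ 2 + lam * (a t) ^ 2) }

/-- A continuously differentiable function vanishing at `L` is `O(L - t)` on `[0, L]`. -/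
theorem exists_abs_le_mul_sub {L : ℝ} {h : ℝ → ℝ} (hL : 0 ≤ L) (hh : ContDiff ℝ 1 h)
    (hLval : h L = 0) : ∃ C : ℝ, 0 ≤ C ∧ ∀ t ∈ Icc (0:ℝ) L, |h t| ≤ C * (L - t) := by
  obtain ⟨C, hC⟩ := (isCompact_Icc (a := (0:ℝ)) (b := L)).exists_bound_of_continuousOn
    (hh.continuous_deriv le_rfl).continuousOn
  refine ⟨C, (norm_nonneg _).trans (hC 0 ⟨le_rfl, hL⟩), fun t ht => ?_⟩
  have key := (convex_Icc (0:ℝ) L).norm_image_sub_le_of_norm_deriv_le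
    (fun x _ => (hh.differentiable one_ne_zero).differentiableAt) hC
    (show L ∈ Icc (0:ℝ) L from ⟨hL, le_rfl⟩) ht
  rwa [hLval, sub_zero, Real.norm_eq_abs, Real.norm_eq_abs, abs_sub_comm t L,
    abs_of_nonneg (sub_nonneg.2 ht.2)] at key

theorem integral_pow_mul_one_sub_sq_le (k : ℕ) :
    ∫ u in (0:ℝ)..1, ((k:ℝ) + 1) ^ 2 * (u ^ (2 * k) * (1 - u) ^ 2) ≤ 1 / ((k:ℝ) + 1) := by
  have expand : ∀ u : ℝ, u ^ (2 * k) * (1 - u) ^ 2 =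
      u ^ (2 * k) - 2 * u ^ (2 * k + 1) + u ^ (2 * k + 2) := fun u => by ring
  simp only [expand]
  rw [integral_const_mul, integral_add (Continuous.intervalIntegrable (by fun_prop) _ _)
      (Continuous.intervalIntegrable (by fun_prop) _ _),
    integral_sub (Continuous.intervalIntegrable (by fun_prop) _ _)
      (Continuous.intervalIntegrable (by fun_prop) _ _), integral_const_mul]
  simp only [integral_pow]
  push_cast
  have hk : (0:ℝ) ≤ k := k.cast_nonneg
  have eval : ((k:ℝ) + 1) ^ 2 * ((1 ^ (2 * k + 1) - 0 ^ (2 * k + 1)) / (2 * k + 1) -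
      2 * ((1 ^ (2 * k + 1 + 1) - 0 ^ (2 * k + 1 + 1)) / (2 * k + 1 + 1)) +
      (1 ^ (2 * k + 2 + 1) - 0 ^ (2 * k + 2 + 1)) / (2 * k + 2 + 1)) =
      ((k:ℝ) + 1) / ((2 * k + 1) * (2 * k + 3)) := by
    simp only [one_pow, zero_pow (Nat.succ_ne_zero _), sub_zero]
    have h1 : (2 * (k:ℝ) + 1) ≠ 0 := by positivity
    have h2 : (2 * (k:ℝ) + 1 + 1) ≠ 0 := by positivity
    have h3 : (2 * (k:ℝ) + 2 + 1) ≠ 0 := by positivity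
    have h4 : (2 * (k:ℝ) + 3) ≠ 0 := by positivity
    field_simp
    ring
  rw [eval, div_le_div_iff₀ (by positivity) (by positivity)]
  nlinarith

/-- The constant function `1` can be perturbed to an admissible function of smaller energy. -/
theorem exists_energy_lt {L lam : ℝ} {h : ℝ → ℝ} (hL : 0 < L) (hlam : 0 < lam)
    (hh : ContDiff ℝ 1 h) (hLval : h L = 0) :
    ∃ a : ℝ → ℝ, ContDiff ℝ 1 a ∧ a 0 = 1 ∧ a L = 0 ∧
      ∫ t in (0:ℝ)..L, ((deriv a t) ^ 2 * (h t) ^ 2 + lam * (a t) ^ 2) < lam * L := by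
  obtain ⟨C, hC0, hC⟩ := exists_abs_le_mul_sub hL.le hh hLval
  obtain ⟨ε, hε0, hε1, hε⟩ : ∃ ε : ℝ, 0 < ε ∧ ε ≤ 1 ∧ 8 * C ^ 2 * ε < lam := by
    refine ⟨min 1 (lam / (8 * C ^ 2 + 1)), by positivity, min_le_left _ _, ?_⟩
    have hpos : 0 < 8 * C ^ 2 + 1 := by positivity
    calc 8 * C ^ 2 * min 1 (lam / (8 * C ^ 2 + 1))
        ≤ 8 * C ^ 2 * (lam / (8 * C ^ 2 + 1)) := by gcongr; exact min_le_right _ _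
      _ < lam := by
        rw [← mul_div_assoc, div_lt_iff₀ hpos]
        nlinarith
  obtain ⟨k, hk⟩ := exists_nat_one_div_lt (show 0 < ε ^ 2 by positivity)
  set a : ℝ → ℝ := fun t => 1 - ε * (t / L) - (1 - ε) * (t / L) ^ (k + 1) with ha
  have hder : ∀ t, deriv a t = -(ε + (1 - ε) * ((k + 1) * (t / L) ^ k)) / L := fun t => by
    have hu : HasDerivAt (fun t : ℝ => t / L) (1 / L) t := (hasDerivAt_id t).div_const L
    have := ((hu.const_mul ε).const_sub 1).sub ((hu.pow (k + 1)).const_mul (1 - ε))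
    refine (HasDerivAt.deriv this).trans ?_
    push_cast
    ring
  have hsmooth : ContDiff ℝ 1 a := by fun_prop
  refine ⟨a, hsmooth, by simp [ha], by simp [ha, hL.ne'], ?_⟩
  set g : ℝ → ℝ := fun u => 2 * C ^ 2 * ε ^ 2 + 2 * C ^ 2 *
    (((k:ℝ) + 1) ^ 2 * (u ^ (2 * k) * (1 - u) ^ 2)) + (lam - lam * ε * u) with hg
  have hbound : ∀ t ∈ Icc (0:ℝ) L,
      (deriv a t) ^ 2 * (h t) ^ 2 + lam * (a t) ^ 2 ≤ g (t / L) := fun t ht => by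
    have hu0 : 0 ≤ t / L := div_nonneg ht.1 hL.le
    have hu1 : t / L ≤ 1 := (div_le_one hL).2 ht.2
    have hht : |h t| ≤ C * (L * (1 - t / L)) := by
      have := hC t ht
      rwa [mul_sub, mul_one, mul_div_cancel₀ _ hL.ne']
    rw [hder]
    simp only [ha, hg]
    generalize t / L = u at *
    have hpow0 : 0 ≤ u ^ k := pow_nonneg hu0 k
    have hpow1 : u ^ k ≤ 1 := pow_le_one₀ hu0 hu1
    have hh2 : (h t) ^ 2 ≤ (C * (L * (1 - u))) ^ 2 := by
      rw [← sq_abs]; gcongr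
    have hfst : (-(ε + (1 - ε) * ((k + 1) * u ^ k)) / L) ^ 2 * (h t) ^ 2 ≤
        2 * C ^ 2 * ε ^ 2 + 2 * C ^ 2 * (((k:ℝ) + 1) ^ 2 * (u ^ (2 * k) * (1 - u) ^ 2)) := by
      calc _ ≤ (-(ε + (1 - ε) * ((k + 1) * u ^ k)) / L) ^ 2 * (C * (L * (1 - u))) ^ 2 := by
            gcongr
        _ = C ^ 2 * ((ε + (1 - ε) * ((k + 1) * u ^ k)) ^ 2 * (1 - u) ^ 2) := by
            field_simp
        _ ≤ C ^ 2 * ((2 * ε ^ 2 + 2 * ((k + 1) * u ^ k) ^ 2) * (1 - u) ^ 2) := by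
            gcongr
            have hq : 0 ≤ ((k:ℝ) + 1) * u ^ k := by positivity
            have hq' : (1 - ε) * ((k + 1) * u ^ k) ≤ (k + 1) * u ^ k := by nlinarith
            have hq'' : 0 ≤ (1 - ε) * ((k + 1) * u ^ k) := mul_nonneg (by linarith) hq
            nlinarith [sq_nonneg (ε - (1 - ε) * ((k + 1) * u ^ k))]
        _ = 2 * C ^ 2 * (ε ^ 2 * (1 - u) ^ 2) +
            2 * C ^ 2 * (((k:ℝ) + 1) ^ 2 * (u ^ (2 * k) * (1 - u) ^ 2)) := by ring
        _ ≤ _ := by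
            gcongr
            have : (1 - u) ^ 2 ≤ 1 := by nlinarith
            nlinarith [sq_nonneg ε]
    have hsnd : (1 - ε * u - (1 - ε) * u ^ (k + 1)) ^ 2 ≤ 1 - ε * u := by
      have hv0 : 0 ≤ u ^ (k + 1) := pow_nonneg hu0 _
      have hv1 : u ^ (k + 1) ≤ u := by rw [pow_succ]; nlinarith
      have hle : 1 - ε * u - (1 - ε) * u ^ (k + 1) ≤ 1 - ε * u := by nlinarith
      have hge : 0 ≤ 1 - ε * u - (1 - ε) * u ^ (k + 1) := by nlinarith
      nlinarith [mul_nonneg hε0.le hu0]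
    nlinarith
  have hgc : Continuous g := by fun_prop
  have hh_cont := hh.continuous
  have hda := hsmooth.continuous_deriv le_rfl
  have hac := hsmooth.continuous
  have hgint : ∫ u in (0:ℝ)..1, g u ≤
      2 * C ^ 2 * ε ^ 2 + 2 * C ^ 2 * (1 / ((k:ℝ) + 1)) + (lam - lam * ε / 2) := by
    simp only [hg]
    rw [integral_add (Continuous.intervalIntegrable (by fun_prop) _ _)
        (Continuous.intervalIntegrable (by fun_prop) _ _),
      integral_add (Continuous.intervalIntegrable (by fun_prop) _ _)
        (Continuous.intervalIntegrable (by fun_prop) _ _),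
      integral_sub (Continuous.intervalIntegrable (by fun_prop) _ _)
        (Continuous.intervalIntegrable (by fun_prop) _ _),
      integral_const_mul (2 * C ^ 2) fun u : ℝ => ((k:ℝ) + 1) ^ 2 * (u ^ (2 * k) * (1 - u) ^ 2),
      integral_const_mul (lam * ε), integral_id,
      integral_const, integral_const]
    have := mul_le_mul_of_nonneg_left (integral_pow_mul_one_sub_sq_le k)
      (show 0 ≤ 2 * C ^ 2 by positivity)
    simp only [smul_eq_mul]
    linarith
  calc _ ≤ ∫ t in (0:ℝ)..L, g (t / L) :=
        integral_mono_on hL.le (Continuous.intervalIntegrable (by fun_prop) _ _)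
          (Continuous.intervalIntegrable (by fun_prop) _ _) hbound
    _ = L * ∫ u in (0:ℝ)..1, g u := by
        rw [integral_comp_div _ hL.ne', zero_div, div_self hL.ne', smul_eq_mul]
    _ < L * lam := by
        refine mul_lt_mul_of_pos_left (hgint.trans_lt ?_) hL
        nlinarith [mul_le_mul_of_nonneg_left hk.le (show 0 ≤ 2 * C ^ 2 by positivity),
          mul_lt_mul_of_pos_left hε hε0]
    _ = lam * L := mul_comm _ _

theorem steklovRayleighRev_le {lam L : ℝ} {h a : ℝ → ℝ} (hL : 0 ≤ L) (hlam : 0 ≤ lam)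
    (ha : ContDiff ℝ 1 a) (ha0 : a 0 = 1) (haL : a L = 0) :
    steklovRayleighRev lam L h ≤ (1 / (h 0) ^ 2) *
      ∫ t in (0:ℝ)..L, ((deriv a t) ^ 2 * (h t) ^ 2 + lam * (a t) ^ 2) := by
  refine csInf_le ⟨0, ?_⟩ ⟨a, ha, ha0, haL, rfl⟩
  rintro x ⟨b, -, -, -, rfl⟩
  exact mul_nonneg (by positivity) (integral_nonneg hL fun t _ => by positivity)

theorem mul_steklovRayleighRev_le {lam lam' L : ℝ} {h : ℝ → ℝ} (hL : 0 < L) (hlam : 0 ≤ lam)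
    (hle : lam ≤ lam') (hh : Continuous h) :
    lam * steklovRayleighRev lam' L h ≤ lam' * steklovRayleighRev lam L h := by
  rcases (hlam.trans hle).eq_or_lt with hzero | hpos
  · have : lam = 0 := le_antisymm (hzero ▸ hle) hlam
    simp [this, ← hzero]
  rw [← div_le_iff₀' hpos]
  refine le_csInf ⟨_, fun t => 1 - t / L, by fun_prop, by simp, by simp [hL.ne'], rfl⟩ ?_
  rintro x ⟨a, ha, ha0, haL, rfl⟩
  rw [div_le_iff₀' hpos]
  have hda := ha.continuous_deriv le_rfl
  have hac := ha.continuous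
  calc _ ≤ lam * ((1 / (h 0) ^ 2) *
        ∫ t in (0:ℝ)..L, ((deriv a t) ^ 2 * (h t) ^ 2 + lam' * (a t) ^ 2)) := by
        gcongr
        exact steklovRayleighRev_le hL.le hpos.le ha ha0 haL
    _ = (1 / (h 0) ^ 2) *
        ∫ t in (0:ℝ)..L, lam * ((deriv a t) ^ 2 * (h t) ^ 2 + lam' * (a t) ^ 2) := by
        rw [integral_const_mul]; ring
    _ ≤ (1 / (h 0) ^ 2) *
        ∫ t in (0:ℝ)..L, lam' * ((deriv a t) ^ 2 * (h t) ^ 2 + lam * (a t) ^ 2) := by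
        gcongr
        refine integral_mono_on hL.le (Continuous.intervalIntegrable (by fun_prop) _ _)
          (Continuous.intervalIntegrable (by fun_prop) _ _) fun t _ => ?_
        nlinarith [mul_le_mul_of_nonneg_right hle
          (show 0 ≤ (deriv a t) ^ 2 * (h t) ^ 2 by positivity)]
    _ = _ := by rw [integral_const_mul]; ring

theorem steklovRev_gap (L lam lam' : ℝ) (hL : 0 < L) (hlam : 0 < lam)
    (hlt : lam < lam') (h : ℝ → ℝ) (hsmooth : ContDiff ℝ (⊤ : ℕ∞) h)
    (hpos : ∀ t ∈ Ico (0:ℝ) L, 0 < h t) (hLval : h L = 0)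
    (hL' : deriv h L = -1) :
    steklovRayleighRev lam' L h - steklovRayleighRev lam L h <
      L * (lam' - lam) / (h 0) ^ 2 := by
  have h0 : 0 < h 0 := hpos 0 ⟨le_rfl, hL⟩
  obtain ⟨a, ha, ha0, haL, henergy⟩ :=
    exists_energy_lt hL hlam (hsmooth.of_le (by exact_mod_cast le_top)) hLval
  have hsigma : steklovRayleighRev lam L h < lam * (L / (h 0) ^ 2) :=
    calc _ ≤ _ := steklovRayleighRev_le hL.le hlam.le ha ha0 haL
      _ < (1 / (h 0) ^ 2) * (lam * L) := by gcongr
      _ = _ := by ring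
  have hscale := mul_steklovRayleighRev_le hL hlam.le hlt.le hsmooth.continuous
  rw [mul_comm L, mul_div_assoc]
  refine lt_of_mul_lt_mul_left ?_ hlam.le
  nlinarith [mul_lt_mul_of_pos_left hsigma (sub_pos.2 hlt)]
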